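/- arXiv:1108.1069 — 2 statements merged into one kernel-verified Lean document; each statement's English description precedes it below -/
import Mathlib

section
/- Let X be a compactum, L a compact Lawson upper semilattice, and R ⊆ exp X × L a subset such that whenever (A,α) ∈ R, A ⊆ A' with A' ∈ exp X, and α' ≤ α, then (A',α') ∈ R. Then R is closed in exp X × L if and only if the following two conditions hold: (1) for every α ∈ L and every filtered collection 𝒜 of elements of exp X with 𝒜×{α} ⊆ R, one has (⋂𝒜, α) ∈ R; (2) for every A ∈ exp X the set {α ∈ L : (A,α) ∈ R} is closed in L. -/
open Set Topology

/-- The hyperspace `exp X` of all nonempty closed subsets of `X`. -/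
structure Exp (X : Type*) [TopologicalSpace X] where
  carrier : Set X
  isClosed' : IsClosed carrier
  nonempty' : carrier.Nonempty

namespace Exp

variable {X : Type*} [TopologicalSpace X]

/-- The Vietoris topology on `exp X`, generated by the subbase consisting of the sets
`⟨U⟩ = {F | F ⊆ U}` and `⟨X, U⟩ = {F | F ∩ U ≠ ∅}` for open `U ⊆ X`. -/
instance topologicalSpace : TopologicalSpace (Exp X) :=
  TopologicalSpace.generateFrom
    ({S | ∃ U : Set X, IsOpen U ∧ S = {F : Exp X | F.carrier ⊆ U}} ∪
     {S | ∃ U : Set X, IsOpen U ∧ S = {F : Exp X | (F.carrier ∩ U).Nonempty}})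

/-- The whole space `X` as an element of `exp X`. -/
def univ (X : Type*) [TopologicalSpace X] [Nonempty X] : Exp X :=
  ⟨Set.univ, isClosed_univ, Set.univ_nonempty⟩

/-- Union of two elements of `exp X`. -/
def union (F G : Exp X) : Exp X :=
  ⟨F.carrier ∪ G.carrier, F.isClosed'.union G.isClosed',
    Set.union_nonempty.mpr (Or.inl F.nonempty')⟩

end Exp

section AmbiguousRepresentations

variable {X Y Z : Type*} [TopologicalSpace X] [TopologicalSpace Y] [TopologicalSpace Z]

/-- An ambiguous representation between `X` and `Y`:
(a) antitone in the first argument and isotone in the second;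
(b) `(A, Y) ∈ R` for all `A`;
(c) all sets `AR = {B | (A,B) ∈ R}` are closed in the Vietoris topology. -/
def IsAmbRep [Nonempty Y] (R : Set (Exp X × Exp Y)) : Prop :=
  (∀ (A A' : Exp X) (B B' : Exp Y),
      (A, B) ∈ R → A'.carrier ⊆ A.carrier → B.carrier ⊆ B'.carrier → (A', B') ∈ R) ∧
  (∀ A : Exp X, (A, Exp.univ Y) ∈ R) ∧
  (∀ A : Exp X, IsClosed {B : Exp Y | (A, B) ∈ R})

/-- The relation `R^⊣ ⊆ exp Y × exp X`: `(B̃, Ã) ∈ R^⊣` iff for every `A ∈ exp X` with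
`A ∩ Ã = ∅` there exists `B ∈ AR` with `B ∩ B̃ = ∅`. -/
def sms (R : Set (Exp X × Exp Y)) : Set (Exp Y × Exp X) :=
  {p | ∀ A : Exp X, A.carrier ∩ p.2.carrier = ∅ →
      ∃ B : Exp Y, (A, B) ∈ R ∧ B.carrier ∩ p.1.carrier = ∅}

/-- A strict ambiguous representation: additionally all sets `RB = {A | (A,B) ∈ R}`
are closed. -/
def IsStrictAmbRep [Nonempty Y] (R : Set (Exp X × Exp Y)) : Prop :=
  IsAmbRep R ∧ ∀ B : Exp Y, IsClosed {A : Exp X | (A, B) ∈ R}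

/-- An open ambiguous representation: strict, pseudo-invertible, and `R^⊣` is strict. -/
def IsOpenAmbRep [Nonempty X] [Nonempty Y] (R : Set (Exp X × Exp Y)) : Prop :=
  IsStrictAmbRep R ∧ sms (sms R) = R ∧ IsStrictAmbRep (sms R)

/-- The composition `R ⊚ S`: `A (R ⊚ S)` is the closure of
`{C | ∃ B, (A,B) ∈ R ∧ (B,C) ∈ S}`. -/
def bcomp (R : Set (Exp X × Exp Y)) (S : Set (Exp Y × Exp Z)) : Set (Exp X × Exp Z) :=
  {p | p.2 ∈ closure {C : Exp Z | ∃ B : Exp Y, (p.1, B) ∈ R ∧ (B, C) ∈ S}}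

/-- The relational composition of `R` and `S`. -/
def rcomp (R : Set (Exp X × Exp Y)) (S : Set (Exp Y × Exp Z)) : Set (Exp X × Exp Z) :=
  {p | ∃ B : Exp Y, (p.1, B) ∈ R ∧ (B, p.2) ∈ S}

end AmbiguousRepresentations

namespace Exp

variable {X : Type*} [TopologicalSpace X]

theorem isOpen_setOf_subset {U : Set X} (hU : IsOpen U) :
    IsOpen {F : Exp X | F.carrier ⊆ U} :=
  TopologicalSpace.isOpen_generateFrom_of_mem (Or.inl ⟨U, hU, rfl⟩)

/-- A filtered family of closed sets in a compact space accumulates at its intersection. -/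
theorem mem_closure_of_filtered [CompactSpace X] {𝒜 : Set (Exp X)} (hne : 𝒜.Nonempty)
    (hdir : ∀ A ∈ 𝒜, ∀ B ∈ 𝒜, ∃ C ∈ 𝒜, C.carrier ⊆ A.carrier ∧ C.carrier ⊆ B.carrier)
    {A₀ : Exp X} (hA₀ : A₀.carrier = ⋂ A ∈ 𝒜, A.carrier) : A₀ ∈ closure 𝒜 := by
  have : Nonempty 𝒜 := hne.to_subtype
  let l : Filter (Exp X) := ⨅ A : 𝒜, Filter.principal {C | C ∈ 𝒜 ∧ C.carrier ⊆ A.1.carrier}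
  have hmem (A : 𝒜) : {C | C ∈ 𝒜 ∧ C.carrier ⊆ A.1.carrier} ∈ l :=
    Filter.mem_iInf_of_mem A (Filter.mem_principal_self _)
  have hl : l.NeBot := by
    refine Filter.iInf_neBot_of_directed' ?_ fun A =>
      Filter.principal_neBot_iff.mpr ⟨A.1, A.2, Subset.rfl⟩
    intro A B
    obtain ⟨C, hC, hCA, hCB⟩ := hdir A.1 A.2 B.1 B.2
    exact ⟨⟨C, hC⟩, Filter.principal_mono.mpr fun D hD => ⟨hD.1, hD.2.trans hCA⟩,
      Filter.principal_mono.mpr fun D hD => ⟨hD.1, hD.2.trans hCB⟩⟩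
  have hlim : Filter.Tendsto id l (𝓝 A₀) := by
    refine TopologicalSpace.tendsto_nhds_generateFrom_iff.mpr ?_
    rintro S (⟨U, hU, rfl⟩ | ⟨U, hU, rfl⟩) hS
    · obtain ⟨A, hA⟩ := exists_subset_nhds_of_isCompact'
        (V := fun A : 𝒜 => A.1.carrier)
        (fun A B => by
          obtain ⟨C, hC, hCA, hCB⟩ := hdir A.1 A.2 B.1 B.2
          exact ⟨⟨C, hC⟩, hCA, hCB⟩)
        (fun A => A.1.isClosed'.isCompact) (fun A => A.1.isClosed')
        (U := U) (fun x hx => hU.mem_nhds (hS (by simpa [hA₀] using hx)))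
      filter_upwards [hmem A] with C hC using hC.2.trans hA
    · obtain ⟨x, hx, hxU⟩ := hS
      rw [hA₀] at hx
      filter_upwards [hmem (Classical.arbitrary 𝒜)] with C hC
      exact ⟨x, mem_iInter₂.mp hx C hC.1, hxU⟩
  exact mem_closure_of_tendsto hlim
    (Filter.mem_of_superset (hmem (Classical.arbitrary 𝒜)) fun _ hC => hC.1)

/-- In a normal Hausdorff space a closed set is the intersection of its closed neighborhoods. -/
theorem carrier_eq_iInter_nhds [T1Space X] [NormalSpace X] (A : Exp X) :
    A.carrier = ⋂ B ∈ {B : Exp X | A.carrier ⊆ interior B.carrier}, B.carrier := by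
  refine Subset.antisymm (subset_iInter₂ fun B hB => hB.trans interior_subset) fun x hx => ?_
  by_contra hxA
  obtain ⟨U, hU, hAU, hUx⟩ := normal_exists_closure_subset A.isClosed'
    (isOpen_compl_singleton (x := x)) (fun y hy hyx => hxA (hyx ▸ hy))
  exact hUx (mem_iInter₂.mp hx ⟨closure U, isClosed_closure, A.nonempty'.mono
    (hAU.trans subset_closure)⟩ (hAU.trans (hU.subset_interior_iff.mpr subset_closure))) rfl

end Exp

/-- Closedness criterion for monotone subsets of `exp X × L` for a compactum `X` and a
compact Lawson upper semilattice `L`. -/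
theorem statement1 {X L : Type*} [TopologicalSpace X] [CompactSpace X] [T2Space X]
    [SemilatticeSup L] [TopologicalSpace L] [CompactSpace L] [T2Space L] [ContinuousSup L]
    (hLawson : ∀ x : L, ∀ N ∈ 𝓝 x, ∃ V ∈ 𝓝 x, V ⊆ N ∧ ∀ a ∈ V, ∀ b ∈ V, a ⊔ b ∈ V)
    (R : Set (Exp X × L))
    (hmono : ∀ (A A' : Exp X) (α α' : L),
      (A, α) ∈ R → A.carrier ⊆ A'.carrier → α' ≤ α → (A', α') ∈ R) :
    IsClosed R ↔
      ((∀ α : L, ∀ 𝒜 : Set (Exp X), 𝒜.Nonempty →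
          (∀ A ∈ 𝒜, ∀ B ∈ 𝒜, ∃ C ∈ 𝒜, C.carrier ⊆ A.carrier ∧ C.carrier ⊆ B.carrier) →
          (∀ A ∈ 𝒜, (A, α) ∈ R) →
          ∀ A0 : Exp X, A0.carrier = ⋂ A ∈ 𝒜, A.carrier → (A0, α) ∈ R) ∧
       (∀ A : Exp X, IsClosed {α : L | (A, α) ∈ R})) := by
  refine ⟨fun hR => ⟨fun α 𝒜 hne hdir h𝒜 A₀ hA₀ => ?_, fun A => ?_⟩, fun ⟨hfilt, hclosed⟩ => ?_⟩
  · have hS : IsClosed {A : Exp X | (A, α) ∈ R} := hR.preimage (by fun_prop)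
    exact closure_minimal h𝒜 hS (Exp.mem_closure_of_filtered hne hdir hA₀)
  · exact hR.preimage (by fun_prop)
  · refine isClosed_of_closure_subset ?_
    rintro ⟨A, α⟩ hA
    refine hfilt α {B | A.carrier ⊆ interior B.carrier} ?_ ?_ ?_ A A.carrier_eq_iInter_nhds
    · exact ⟨⟨Set.univ, isClosed_univ, A.nonempty'.mono (subset_univ _)⟩, by simp⟩
    · intro B hB C hC
      have hBC : A.carrier ⊆ interior (B.carrier ∩ C.carrier) := by
        rw [interior_inter]
        exact subset_inter hB hC
      exact ⟨⟨B.carrier ∩ C.carrier, B.isClosed'.inter C.isClosed',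
        A.nonempty'.mono (hBC.trans interior_subset)⟩, hBC, inter_subset_left, inter_subset_right⟩
    · intro B hB
      refine (hclosed B).closure_subset (mem_closure_iff_nhds.mpr fun V hV => ?_)
      obtain ⟨⟨C, β⟩, ⟨hC, hβ⟩, hR⟩ := mem_closure_iff_nhds.mp hA _
        (prod_mem_nhds ((Exp.isOpen_setOf_subset isOpen_interior).mem_nhds hB) hV)
      exact ⟨β, hβ, hmono C B β β hR (hC.trans interior_subset) le_rfl⟩
end

section
/- Let X, Y be compacta and R ⊆ exp X × exp Y a strict pseudo-invertible ambiguous representation. Then R^⊣ is strict (i.e. R is an open ambiguous representation) if and only if for every open U ⊆ X the set {C ∈ exp Y : C is R-unavoidable for some A ∈ exp X with A ⊆ U} is open in the Vietoris topology on exp Y. -/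
open Set Topology

theorem Exp.isOpen_setOf_subset_s11 {X : Type*} [TopologicalSpace X] {U : Set X} (hU : IsOpen U) :
    IsOpen {F : Exp X | F.carrier ⊆ U} :=
  TopologicalSpace.isOpen_generateFrom_of_mem (Or.inl ⟨U, hU, rfl⟩)

/-- The family of sets unavoidable for some `A ⊆ U` is the complement of the section of `R^⊣`
over the complement of `U`. -/
theorem setOf_unavoidable_eq_compl_sms {X Y : Type*} [TopologicalSpace X] [TopologicalSpace Y]
    (R : Set (Exp X × Exp Y)) {U : Set X} {F : Exp X} (hF : F.carrier = Uᶜ) :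
    {C : Exp Y | ∃ A : Exp X, A.carrier ⊆ U ∧
      ∀ B : Exp Y, (A, B) ∈ R → (C.carrier ∩ B.carrier).Nonempty} =
    {C : Exp Y | (C, F) ∈ sms R}ᶜ := by
  ext C
  simp only [sms, mem_ofPred_eq, mem_compl_iff, not_forall, not_exists, not_and, exists_prop, hF,
    ← disjoint_iff_inter_eq_empty, disjoint_compl_right_iff_subset, not_disjoint_iff_nonempty_inter,
    inter_comm C.carrier]

/-- The relation `R^⊣` is always an ambiguous representation. -/
theorem isAmbRep_sms {X Y : Type*} [TopologicalSpace X] [Nonempty X] [TopologicalSpace Y]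
    (R : Set (Exp X × Exp Y)) : IsAmbRep (sms R) := by
  refine ⟨fun C C' F F' h hC hF A hA => ?_, fun C A hA => ?_, fun C => ?_⟩
  · obtain ⟨B, hB, hBC⟩ :=
      h A (subset_empty_iff.mp (hA ▸ inter_subset_inter_right A.carrier hF))
    exact ⟨B, hB, subset_empty_iff.mp (hBC ▸ inter_subset_inter_right B.carrier hC)⟩
  · exact absurd hA (by simpa [Exp.univ] using A.nonempty'.ne_empty)
  · have hset : {F : Exp X | (C, F) ∈ sms R} =
        ⋂ (A : Exp X) (_ : ¬ ∃ B : Exp Y, (A, B) ∈ R ∧ B.carrier ∩ C.carrier = ∅),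
          {F : Exp X | F.carrier ⊆ A.carrierᶜ}ᶜ := by
      ext F
      simp only [sms, mem_ofPred_eq, mem_iInter, mem_compl_iff, subset_compl_iff_disjoint_left,
        disjoint_iff_inter_eq_empty]
      exact forall_congr' fun A => not_imp_not.symm
    rw [hset]
    exact isClosed_iInter fun A => isClosed_iInter fun _ =>
      (Exp.isOpen_setOf_subset_s11 A.isClosed'.isOpen_compl).isClosed_compl

/-- For a pseudo-invertible `R`, only the whole space is related to the whole space. -/
theorem carrier_eq_univ_of_univ_mem {X Y : Type*} [TopologicalSpace X] [Nonempty X]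
    [TopologicalSpace Y] [T1Space Y] {R : Set (Exp X × Exp Y)} (hpi : sms (sms R) = R)
    {B : Exp Y} (h : (Exp.univ X, B) ∈ R) : B.carrier = Set.univ := by
  refine eq_univ_of_forall fun y => by_contra fun hy => ?_
  rw [← hpi] at h
  obtain ⟨F, -, hF⟩ := h ⟨{y}, isClosed_singleton, singleton_nonempty y⟩ (by simpa using hy)
  exact F.nonempty'.ne_empty (by simpa [Exp.univ] using hF)

/-- For a strict pseudo-invertible ambiguous representation `R`, `R^⊣` is strict (i.e. `R`
is open) iff for every open `U ⊆ X` the family of sets `R`-unavoidable for some `A ⊆ U` is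
open in the Vietoris topology on `exp Y`. -/
theorem statement11 {X Y : Type*}
    [TopologicalSpace X] [CompactSpace X] [T2Space X] [Nonempty X]
    [TopologicalSpace Y] [CompactSpace Y] [T2Space Y] [Nonempty Y]
    (R : Set (Exp X × Exp Y)) (hR : IsStrictAmbRep R) (hpi : sms (sms R) = R) :
    IsStrictAmbRep (sms R) ↔
      ∀ U : Set X, IsOpen U →
        IsOpen {C : Exp Y | ∃ A : Exp X, A.carrier ⊆ U ∧
          ∀ B : Exp Y, (A, B) ∈ R → (C.carrier ∩ B.carrier).Nonempty} := by
  constructor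
  · rintro ⟨-, hs⟩ U hU
    by_cases hne : Uᶜ.Nonempty
    · rw [setOf_unavoidable_eq_compl_sms R (F := ⟨Uᶜ, hU.isClosed_compl, hne⟩) rfl]
      exact (hs _).isOpen_compl
    · have hU' : U = Set.univ := by simpa [not_nonempty_iff_eq_empty] using hne
      convert isOpen_univ
      refine eq_univ_of_forall fun C => ⟨Exp.univ X, hU'.symm ▸ subset_univ _, fun B hB => ?_⟩
      rw [carrier_eq_univ_of_univ_mem hpi hB, inter_univ]
      exact C.nonempty'
  · refine fun h => ⟨isAmbRep_sms R, fun F => ?_⟩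
    have hF := h F.carrierᶜ F.isClosed'.isOpen_compl
    rw [setOf_unavoidable_eq_compl_sms R (compl_compl F.carrier).symm] at hF
    exact isOpen_compl_iff.mp hF
end
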